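/- Let L = 1/(u_1·u_{1..2}) and R = 1/(u_{1..2}·u_2) in Mould(2). Then the dendriform relations hold: (i) L ∘_1 (L+R) = L ∘_2 L; (ii) R ∘_1 L = L ∘_2 R; (iii) R ∘_1 R = R ∘_2 (L+R); and the push acts by (iv) τ(L) = R and τ(R) = −(L+R). (These identities express that sending the two dendriform generators to L and R defines a morphism of anticyclic non-symmetric operads from Dend to Mould.) -/

import Mathlib

/-!
Formalization of results from "The anticyclic operad of moulds" (F. Chapoton).

`Mould n` is the field of rational functions in variables `u 1, …, u n` with
rational coefficients, realized as a subfield of the fraction field `K` of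
`ℚ[X 0, X 1, X 2, …]`.  The variable `u 0 = X 0` is reserved as an auxiliary
variable (the parameter `t` or `λ`).  Substitution of rational functions for
the variables is realized by the (partial, well-defined) function `msub`.
-/

noncomputable section
namespace MouldOperad

open MvPolynomial Finset

attribute [local instance] Classical.propDecidable
set_option synthInstance.maxHeartbeats 1000000

abbrev MPoly : Type := MvPolynomial ℕ ℚ
abbrev K : Type := FractionRing MPoly

/-- the variable `u i` (1-based; index `0` is auxiliary). -/
def u (i : ℕ) : K := algebraMap MPoly K (X i)

/-- `u_{i..j} = u_i + u_{i+1} + ⋯ + u_j`. -/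
def usum (i j : ℕ) : K := ∑ k ∈ Finset.Icc i j, u k

/-- evaluation of polynomials, sending the variable `X k` to `v k`. -/
def pev (v : ℕ → K) : MPoly →+* K :=
  eval₂Hom ((algebraMap MPoly K).comp (C : ℚ →+* MPoly)) v

/-- Substitution of the rational functions `v k` for the variables of `f ∈ K`
(the induced field homomorphism): it takes the canonical value whenever `f` has
a fraction representation whose denominator does not vanish under the
substitution (this value does not depend on the representation), and the junk
value `0` otherwise. -/
def msub (v : ℕ → K) (f : K) : K :=
  if h : ∃ w : K, ∃ p q : MPoly, q ≠ 0 ∧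
      f = algebraMap MPoly K p / algebraMap MPoly K q ∧
      pev v q ≠ 0 ∧ w = pev v p / pev v q
  then h.choose else 0

/-- the field `Mould n` of rational functions in `u 1, …, u n`. -/
def Mould (n : ℕ) : Subfield K :=
  Subfield.closure {x : K | ∃ i, 1 ≤ i ∧ i ≤ n ∧ x = u i}

/-- substitution used for `f` in `f ∘_i g`, where `g` has degree `n`:
`f(u_1, …, u_{i-1}, u_{i..i+n-1}, u_{i+n}, …, u_{m+n-1})`. -/
def compSubF (n i : ℕ) : ℕ → K := fun k =>
  if k < i then u k else if k = i then usum i (i + n - 1) else u (k + n - 1)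

/-- substitution used for `g` in `f ∘_i g` : `g(u_i, …, u_{i+n-1})`. -/
def compSubG (i : ℕ) : ℕ → K := fun k => u (k + i - 1)

/-- the composition `f ∘_i g`, where `g` has degree `n` (1-based index `i`). -/
def comp (n i : ℕ) (f g : K) : K :=
  usum i (i + n - 1) * msub (compSubF n i) f * msub (compSubG i) g

/-- the push `τ` on `Mould n`: `τ(f)(u_1,…,u_n) = f(-u_{1..n}, u_1, …, u_{n-1})`. -/
def push (n : ℕ) (f : K) : K :=
  msub (fun k => if k = 1 then -(usum 1 n) else if k ≤ n then u (k - 1) else u k) f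

/-- a permutation of `Fin n` as a (1-based) permutation of `ℕ`. -/
def permExt (n : ℕ) (σ : Equiv.Perm (Fin n)) : ℕ → ℕ := fun k =>
  if h : 1 ≤ k ∧ k ≤ n then ((σ ⟨k - 1, by omega⟩ : Fin n) : ℕ) + 1 else k

/-- `f ∈ Mould n` is alternal : for each `1 ≤ i ≤ n-1`, the sum of
`f(u_{σ(1)}, …, u_{σ(n)})` over the shuffles `σ ∈ Sh(i, n-i)` vanishes. -/
def IsAlternal (n : ℕ) (f : K) : Prop :=
  ∀ i : ℕ, 1 ≤ i → i ≤ n - 1 →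
    ∑ σ ∈ Finset.univ.filter (fun σ : Equiv.Perm (Fin n) =>
        (∀ a b : Fin n, a < b → (b : ℕ) < i → σ a < σ b) ∧
        (∀ a b : Fin n, a < b → i ≤ (a : ℕ) → σ a < σ b)),
      msub (fun k => u (permExt n σ k)) f = 0

/-- `f ∈ Mould n` is vegetal :
`u_1⋯u_n · Σ_{σ ∈ S_n} f(t·u_{σ(1)}, …, t·u_{σ(n)}) = n! · f(t,…,t)`,
where the auxiliary variable `t` is `u 0`. -/
def IsVegetal (n : ℕ) (f : K) : Prop :=
  (∏ k ∈ Finset.Icc 1 n, u k) *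
      ∑ σ : Equiv.Perm (Fin n), msub (fun k => u 0 * u (permExt n σ k)) f =
    (n.factorial : K) * msub (fun _ => u 0) f

/-- `f ∈ Mould n` is homogeneous of weight `d` : `f(λu_1,…,λu_n) = λ^d·f`,
where the auxiliary variable `λ` is `u 0`. -/
def IsHomogeneousOfWeight (n : ℕ) (d : ℤ) (f : K) : Prop :=
  msub (fun k => if 1 ≤ k ∧ k ≤ n then u 0 * u k else u k) f = u 0 ^ d * f

/-- shift substitution : `g(u_{m+1}, …, u_{m+n})`. -/
def shiftSub (m : ℕ) : ℕ → K := fun k => u (k + m)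

/-- `f ≻ g` for `f ∈ Mould m`, `g ∈ Mould n`. -/
def dsucc (m n : ℕ) (f g : K) : K :=
  f * msub (shiftSub m) g * usum (m + 1) (m + n) / usum 1 (m + n)

/-- `f ≺ g` for `f ∈ Mould m`, `g ∈ Mould n`. -/
def dprec (m n : ℕ) (f g : K) : K :=
  f * msub (shiftSub m) g * usum 1 m / usum 1 (m + n)

/-- `MU(f,g)` for `f ∈ Mould m`. -/
def MU (m : ℕ) (f g : K) : K := f * msub (shiftSub m) g

/-- `LIMU(f,g) = MU(f,g) - MU(g,f)` for `f ∈ Mould m`, `g ∈ Mould n`. -/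
def LIMU (m n : ℕ) (f g : K) : K := MU m f g - MU n g f

/-- the pre-Lie product `f ↶ g` for `f ∈ Mould m`, `g ∈ Mould n`. -/
def preLieCurve (m n : ℕ) (f g : K) : K :=
  f * msub (shiftSub m) g * usum (m + 1) (m + n) / usum 1 (m + n)
    - g * msub (shiftSub n) f * usum 1 n / usum 1 (m + n)

/-- the pre-Lie product `f ∘ g = Σ_{i=1}^m f ∘_i g`, `f ∈ Mould m`, `g ∈ Mould n`. -/
def preLieComp (m n : ℕ) (f g : K) : K := ∑ i ∈ Finset.Icc 1 m, comp n i f g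

/-- `H_n = ∏_{1 ≤ i ≤ j ≤ n} u_{i..j}`. -/
def Hprod (n : ℕ) : K := ∏ i ∈ Finset.Icc 1 n, ∏ j ∈ Finset.Icc i n, usum i j

/-- `x` is (the image of) a polynomial in `u_1, …, u_n`. -/
def IsPolyIn (n : ℕ) (x : K) : Prop :=
  ∃ p : MPoly, (∀ k ∈ p.vars, 1 ≤ k ∧ k ≤ n) ∧ x = algebraMap MPoly K p

/-- `f ∈ Mould n` has nice poles: it is a polynomial divided by a product of
powers of the linear forms `u_{i..j}`, `1 ≤ i ≤ j ≤ n`. -/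
def HasNicePoles (n : ℕ) (f : K) : Prop :=
  ∃ (P : MPoly) (e : ℕ → ℕ → ℕ),
    (∀ k ∈ P.vars, 1 ≤ k ∧ k ≤ n) ∧
    f = algebraMap MPoly K P /
        ∏ i ∈ Finset.Icc 1 n, ∏ j ∈ Finset.Icc i n, usum i j ^ e i j

/-- the Over product `f / Y`, `f ∈ Mould n`. -/
def overY (n : ℕ) (f : K) : K := f / usum 1 (n + 1)

/-- the Under product `Y \ f`, `f ∈ Mould n`. -/
def underY (n : ℕ) (f : K) : K := msub (fun k => u (k + 1)) f / usum 1 (n + 1)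

/-- `ARIT(f,g) = f ∘ (g/Y) - f ∘ (Y\g)` for `f ∈ Mould m`, `g ∈ Mould n`. -/
def ARIT (m n : ℕ) (f g : K) : K :=
  preLieComp m (n + 1) f (overY n g) - preLieComp m (n + 1) f (underY n g)

/-- `ARI(f,g) = ARIT(f,g) - ARIT(g,f) + LIMU(f,g)`, `f ∈ Mould m`, `g ∈ Mould n`. -/
def ARI (m n : ℕ) (f g : K) : K := ARIT m n f g - ARIT n m g f + LIMU m n f g

/-- evaluation of polynomials into `RatFunc K` (rational functions in `t` over `K`). -/
def pevR (v : ℕ → RatFunc K) : MPoly →+* RatFunc K :=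
  eval₂Hom ((RatFunc.C).comp ((algebraMap MPoly K).comp (C : ℚ →+* MPoly))) v

/-- substitution into `RatFunc K`. -/
def msubR (v : ℕ → RatFunc K) (f : K) : RatFunc K :=
  if h : ∃ w : RatFunc K, ∃ p q : MPoly, q ≠ 0 ∧
      f = algebraMap MPoly K p / algebraMap MPoly K q ∧
      pevR v q ≠ 0 ∧ w = pevR v p / pevR v q
  then h.choose else 0

/-- residue at `t = 0`: the coefficient of `t⁻¹` in the Laurent expansion at `0`. -/
def res (r : RatFunc K) : K := (↑r : LaurentSeries K).coeff (-1)

/-- the mould derivative `∂f` for `f ∈ Mould m`: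
`∂f(u_1,…,u_{m-1}) = Σ_{j=1}^m Res_{t=0} f(u_1,…,u_{j-1},t,u_j,…,u_{m-1})`,
where `f(u_1,…,u_{j-1},t,u_j,…,u_{m-1})` is viewed in `RatFunc K`. -/
def mderiv (m : ℕ) (f : K) : K :=
  ∑ j ∈ Finset.Icc 1 m,
    res (msubR (fun k =>
      if k < j then RatFunc.C (u k)
      else if k = j then RatFunc.X
      else RatFunc.C (u (k - 1))) f)

/-- evaluation of polynomials into `ℚ(x)`, sending every variable to `1/x`. -/
def pevX : MPoly →+* RatFunc ℚ :=
  eval₂Hom (RatFunc.C : ℚ →+* RatFunc ℚ) (fun _ => (RatFunc.X)⁻¹)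

/-- the substitution `u_i ↦ 1/x`, landing in `ℚ(x)`. -/
def evalx (f : K) : RatFunc ℚ :=
  if h : ∃ w : RatFunc ℚ, ∃ p q : MPoly, q ≠ 0 ∧
      f = algebraMap MPoly K p / algebraMap MPoly K q ∧
      pevX q ≠ 0 ∧ w = pevX p / pevX q
  then h.choose else 0

/-- the derivative `d/dx` on `ℚ(x)`. -/
def rfDeriv (r : RatFunc ℚ) : RatFunc ℚ :=
  (algebraMap (Polynomial ℚ) (RatFunc ℚ) (Polynomial.derivative r.num) *
      algebraMap (Polynomial ℚ) (RatFunc ℚ) r.denom -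
    algebraMap (Polynomial ℚ) (RatFunc ℚ) r.num *
      algebraMap (Polynomial ℚ) (RatFunc ℚ) (Polynomial.derivative r.denom)) /
    algebraMap (Polynomial ℚ) (RatFunc ℚ) r.denom ^ 2

@[simp] theorem pev_X (v : ℕ → K) (k : ℕ) : pev v (X k) = v k := by
  simp [pev]

/-- `msub` computes the substitution on any fraction representation whose denominator survives. -/
theorem msub_div (v : ℕ → K) (p q : MPoly) (hq : pev v q ≠ 0) :
    msub v (algebraMap MPoly K p / algebraMap MPoly K q) = pev v p / pev v q := by
  have ne_zero_of_pev : ∀ r : MPoly, pev v r ≠ 0 → r ≠ 0 := by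
    rintro r hr rfl
    exact hr (map_zero _)
  have h : ∃ w : K, ∃ p' q' : MPoly, q' ≠ 0 ∧
      algebraMap MPoly K p / algebraMap MPoly K q =
        algebraMap MPoly K p' / algebraMap MPoly K q' ∧
      pev v q' ≠ 0 ∧ w = pev v p' / pev v q' :=
    ⟨_, p, q, ne_zero_of_pev q hq, rfl, hq, rfl⟩
  rw [msub, dif_pos h]
  obtain ⟨p', q', hq'0, heq, hq', hw⟩ := h.choose_spec
  rw [hw, div_eq_div_iff hq' hq, ← map_mul, ← map_mul]
  have inj := IsFractionRing.injective MPoly K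
  have image_ne_zero : ∀ r : MPoly, r ≠ 0 → algebraMap MPoly K r ≠ 0 := fun r hr =>
    (map_ne_zero_iff _ inj).2 hr
  rw [div_eq_div_iff (image_ne_zero q (ne_zero_of_pev q hq)) (image_ne_zero q' hq'0),
    ← map_mul, ← map_mul] at heq
  exact congrArg (pev v) (inj heq).symm

theorem msub_inv (v : ℕ → K) (q : MPoly) (hq : pev v q ≠ 0) :
    msub v (algebraMap MPoly K q)⁻¹ = (pev v q)⁻¹ := by
  simpa using msub_div v 1 q hq

theorem usum_ne_zero {i j : ℕ} (hij : i ≤ j) : usum i j ≠ 0 := by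
  have h : usum i j = algebraMap MPoly K (∑ k ∈ Finset.Icc i j, X k) := by
    simp [usum, u]
  rw [h, map_ne_zero_iff _ (IsFractionRing.injective MPoly K)]
  intro h0
  have h1 := congrArg (eval fun _ => (1 : ℚ)) h0
  simp only [map_sum, eval_X, map_zero, sum_const, Nat.card_Icc, nsmul_eq_mul, mul_one,
    Nat.cast_eq_zero] at h1
  omega

theorem usum_self (i : ℕ) : usum i i = u i := by
  simp [usum]

theorem usum_succ {i j : ℕ} (hij : i ≤ j + 1) : usum i (j + 1) = usum i j + u (j + 1) :=
  Finset.sum_Icc_succ_top hij u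

theorem u_ne_zero (i : ℕ) : u i ≠ 0 :=
  usum_self i ▸ usum_ne_zero le_rfl

theorem usum_one_two : usum 1 2 = u 1 + u 2 := by
  rw [usum_succ (by norm_num), usum_self]

theorem usum_two_three : usum 2 3 = u 2 + u 3 := by
  rw [usum_succ (by norm_num), usum_self]

theorem usum_one_three : usum 1 3 = u 1 + u 2 + u 3 := by
  rw [usum_succ (by norm_num), usum_one_two]

theorem msub_left (v : ℕ → K) (h1 : v 1 ≠ 0) (h12 : v 1 + v 2 ≠ 0) :
    msub v (u 1 * usum 1 2)⁻¹ = (v 1 * (v 1 + v 2))⁻¹ := by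
  have h := msub_inv v (X 1 * (X 1 + X 2)) (by simp [h1, h12])
  simpa only [map_mul, map_add, pev_X, usum_one_two, u] using h

theorem msub_right (v : ℕ → K) (h2 : v 2 ≠ 0) (h12 : v 1 + v 2 ≠ 0) :
    msub v (usum 1 2 * u 2)⁻¹ = ((v 1 + v 2) * v 2)⁻¹ := by
  have h := msub_inv v ((X 1 + X 2) * X 2) (by simp [h2, h12])
  simpa only [map_mul, map_add, pev_X, usum_one_two, u] using h

theorem left_add_right :
    (u 1 * usum 1 2)⁻¹ + (usum 1 2 * u 2)⁻¹ = (u 1 * u 2)⁻¹ := by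
  have h1 := u_ne_zero 1
  have h2 := u_ne_zero 2
  have h12 : u 1 + u 2 ≠ 0 := usum_one_two ▸ usum_ne_zero (by norm_num)
  rw [usum_one_two]
  field_simp
  ring

theorem msub_left_add_right (v : ℕ → K) (h1 : v 1 ≠ 0) (h2 : v 2 ≠ 0) :
    msub v ((u 1 * usum 1 2)⁻¹ + (usum 1 2 * u 2)⁻¹) = (v 1 * v 2)⁻¹ := by
  have h := msub_inv v (X 1 * X 2) (by simp [h1, h2])
  rw [left_add_right]
  simpa only [map_mul, pev_X, u] using h

/-- with `L = 1/(u_1·u_{1..2})` and `R = 1/(u_{1..2}·u_2)` in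
`Mould 2`, the dendriform relations hold:
`L ∘_1 (L+R) = L ∘_2 L`, `R ∘_1 L = L ∘_2 R`, `R ∘_1 R = R ∘_2 (L+R)`,
and the push acts by `τ(L) = R`, `τ(R) = -(L+R)`. -/
theorem dendriform_relations (L R : K)
    (hL : L = (u 1 * usum 1 2)⁻¹) (hR : R = (usum 1 2 * u 2)⁻¹) :
    comp 2 1 L (L + R) = comp 2 2 L L ∧
    comp 2 1 R L = comp 2 2 L R ∧
    comp 2 1 R R = comp 2 2 R (L + R) ∧
    push 2 L = R ∧
    push 2 R = -(L + R) := by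
  subst hL hR
  have h1 := u_ne_zero 1
  have h2 := u_ne_zero 2
  have h3 := u_ne_zero 3
  have h12 : u 1 + u 2 ≠ 0 := usum_one_two ▸ usum_ne_zero (by norm_num)
  have h23 : u 2 + u 3 ≠ 0 := usum_two_three ▸ usum_ne_zero (by norm_num)
  have h123 : u 1 + u 2 + u 3 ≠ 0 := usum_one_three ▸ usum_ne_zero (by norm_num)
  have h123' : u 1 + (u 2 + u 3) ≠ 0 := add_assoc (u 1) (u 2) (u 3) ▸ h123
  have f11 : compSubF 2 1 1 = u 1 + u 2 := by simp [compSubF, usum_one_two]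
  have f12 : compSubF 2 1 2 = u 3 := by simp [compSubF]
  have f21 : compSubF 2 2 1 = u 1 := by simp [compSubF]
  have f22 : compSubF 2 2 2 = u 2 + u 3 := by simp [compSubF, usum_two_three]
  have g11 : compSubG 1 1 = u 1 := rfl
  have g12 : compSubG 1 2 = u 2 := rfl
  have g21 : compSubG 2 1 = u 2 := rfl
  have g22 : compSubG 2 2 = u 3 := rfl
  have s1 : usum 1 (1 + 2 - 1) = u 1 + u 2 := usum_one_two
  have s2 : usum 2 (2 + 2 - 1) = u 2 + u 3 := usum_two_three
  refine ⟨?_, ?_, ?_, ?_, ?_⟩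
  · rw [comp, comp, msub_left, msub_left_add_right, msub_left, msub_left, f11, f12, f21, f22,
      g11, g12, g21, g22, s1, s2]
    · field_simp
      ring
    all_goals simpa only [f11, f12, f21, f22, g11, g12, g21, g22]
  · rw [comp, comp, msub_right, msub_left, msub_left, msub_right, f11, f12, f21, f22,
      g11, g12, g21, g22, s1, s2]
    · field_simp
      ring
    all_goals simpa only [f11, f12, f21, f22, g11, g12, g21, g22]
  · rw [comp, comp, msub_right, msub_right, msub_right, msub_left_add_right, f11, f12, f21, f22,
      g11, g12, g21, g22, s1, s2]
    · field_simp
      ring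
    all_goals simpa only [f11, f12, f21, f22, g11, g12, g21, g22]
  · have hsum : -(u 1 + u 2) + u 1 = -u 2 := by ring
    rw [push, msub_left]
    · norm_num only [usum_one_two, if_true, if_false, hsum, neg_mul_neg]
    · simpa only [if_true, usum_one_two] using neg_ne_zero.2 h12
    · norm_num only [usum_one_two, if_true, if_false, hsum]
      exact neg_ne_zero.2 h2
  · rw [push, msub_right, left_add_right]
    · simp [usum_one_two, mul_comm]
    all_goals simp [usum_one_two, h1, h2]

end MouldOperad
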